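/- Let H, j, N, A, B, Q_σ, λ_j(σ) be as in the min–max setting. Let σ₁, σ₂ ∈ (1/2,1) and assume λ_j(min{σ₁,σ₂}) < ∞. Then λ_j(σ₁) and λ_j(σ₂) are finite and |λ_j(σ₁) − λ_j(σ₂)| ≤ (λ_j(min{σ₁,σ₂})/(1−min{σ₁,σ₂}))·|σ₁−σ₂|. -/

import Mathlib

open scoped ENNReal

/-- The `j`-th min–max value of a functional `Q` on a real inner product space. -/
noncomputable def minmaxVal {H : Type*} [NormedAddCommGroup H] [InnerProductSpace ℝ H]
    (j : ℕ) (Q : H → ℝ) : ℝ≥0∞ :=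
  ⨅ (E : Submodule ℝ H) (_ : Module.finrank ℝ E = j),
    ⨆ (u : H) (_ : u ∈ E) (_ : u ≠ 0), ENNReal.ofReal (Q u / ‖u‖ ^ 2)

/-- If `Q ≤ c * Q'` pointwise with `c > 0`, the min–max values satisfy the same inequality. -/
theorem minmaxVal_le_ofReal_mul {H : Type*} [NormedAddCommGroup H] [InnerProductSpace ℝ H]
    (j : ℕ) {Q Q' : H → ℝ} {c : ℝ} (hc : 0 < c) (h : ∀ u, Q u ≤ c * Q' u) :
    minmaxVal j Q ≤ ENNReal.ofReal c * minmaxVal j Q' := by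
  have hc0 : ENNReal.ofReal c ≠ 0 := by simpa using hc
  unfold minmaxVal
  simp only [ENNReal.mul_iInf_of_ne hc0 ENNReal.ofReal_ne_top, ENNReal.mul_iSup]
  refine iInf₂_mono fun E _ => iSup₂_mono fun u _ => iSup_mono fun _ => ?_
  rw [← ENNReal.ofReal_mul hc.le, ← mul_div_assoc]
  exact ENNReal.ofReal_le_ofReal (div_le_div_of_nonneg_right (h u) (by positivity))

/-- One-sided form of the estimate: for `1 / 2 < s ≤ t < 1`, the min–max value of
`(1 - t) * A + t * B` is controlled by that of `(1 - s) * A + s * B`. -/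
theorem minmaxVal_convexComb_sub_le {H : Type*} [NormedAddCommGroup H] [InnerProductSpace ℝ H]
    (j : ℕ) {A B : H → ℝ} (hA : ∀ u, 0 ≤ A u) (hB : ∀ u, 0 ≤ B u) {s t : ℝ}
    (hs : 1 / 2 < s) (hst : s ≤ t) (ht : t < 1)
    (hfin : minmaxVal j (fun u => (1 - s) * A u + s * B u) < ⊤) :
    minmaxVal j (fun u => (1 - t) * A u + t * B u) < ⊤ ∧
      |(minmaxVal j (fun u => (1 - s) * A u + s * B u)).toReal
          - (minmaxVal j (fun u => (1 - t) * A u + t * B u)).toReal|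
        ≤ (minmaxVal j (fun u => (1 - s) * A u + s * B u)).toReal / (1 - s) * (t - s) := by
  have hs0 : 0 < s := by linarith
  have hs1 : 0 < 1 - s := by linarith
  have ht1 : 0 < 1 - t := by linarith
  have upper := minmaxVal_le_ofReal_mul j (Q := fun u => (1 - t) * A u + t * B u)
    (Q' := fun u => (1 - s) * A u + s * B u) (c := t / s) (div_pos (by linarith) hs0) (by
      intro u
      rw [div_mul_eq_mul_div, le_div_iff₀ hs0]
      nlinarith [mul_nonneg (sub_nonneg.2 hst) (hA u)])
  have lower := minmaxVal_le_ofReal_mul j (Q := fun u => (1 - s) * A u + s * B u)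
    (Q' := fun u => (1 - t) * A u + t * B u) (c := (1 - s) / (1 - t)) (div_pos hs1 ht1) (by
      intro u
      rw [div_mul_eq_mul_div, le_div_iff₀ ht1]
      nlinarith [mul_nonneg (sub_nonneg.2 hst) (hB u)])
  generalize minmaxVal j (fun u => (1 - s) * A u + s * B u) = x at *
  generalize minmaxVal j (fun u => (1 - t) * A u + t * B u) = y at *
  have hy : y < ⊤ := upper.trans_lt (ENNReal.mul_lt_top ENNReal.ofReal_lt_top hfin)
  refine ⟨hy, ?_⟩
  lift x to NNReal using hfin.ne
  lift y to NNReal using hy.ne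
  have hu := ENNReal.toReal_mono (ENNReal.mul_ne_top ENNReal.ofReal_ne_top hfin.ne) upper
  have hl := ENNReal.toReal_mono (ENNReal.mul_ne_top ENNReal.ofReal_ne_top hy.ne) lower
  rw [ENNReal.toReal_mul, ENNReal.toReal_ofReal (div_pos (by linarith) hs0).le,
    div_mul_eq_mul_div, le_div_iff₀ hs0] at hu
  rw [ENNReal.toReal_mul, ENNReal.toReal_ofReal (div_pos hs1 ht1).le,
    div_mul_eq_mul_div, le_div_iff₀ ht1] at hl
  simp only [ENNReal.coe_toReal] at hu hl ⊢
  have hx0 : 0 ≤ (x : ℝ) := x.2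
  rw [div_mul_eq_mul_div, le_div_iff₀ hs1, ← abs_of_pos hs1, ← abs_mul, abs_le]
  have hxt : 0 ≤ (x : ℝ) * (t - s) := mul_nonneg hx0 (sub_nonneg.2 hst)
  constructor
  · rcases le_total (y : ℝ) x with hyx | hxy
    · nlinarith [mul_nonneg (sub_nonneg.2 hyx) hs1.le]
    · nlinarith [mul_nonneg (sub_nonneg.2 hxy) (by linarith : (0 : ℝ) ≤ s - (1 - s))]
  · nlinarith

/-- Refined estimate (estimate2) in Step 3 of the proof of Theorem 3.1,
for Poisson ratios `σ₁, σ₂ ∈ (1/2, 1)`. -/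
theorem stmt_5 {H : Type*} [NormedAddCommGroup H] [InnerProductSpace ℝ H]
    (j : ℕ) (hj : 1 ≤ j) (hex : ∃ E : Submodule ℝ H, Module.finrank ℝ E = j)
    (N : ℕ) (hN : 1 ≤ N) (A B : H → ℝ)
    (hB : ∀ u, 0 ≤ B u) (hBA : ∀ u, B u ≤ (N : ℝ) * A u)
    (lam : ℝ → ℝ≥0∞)
    (hlam : ∀ σ, lam σ = minmaxVal j (fun u => (1 - σ) * A u + σ * B u))
    (σ₁ σ₂ : ℝ) (hσ₁ : σ₁ ∈ Set.Ioo (1 / 2 : ℝ) 1) (hσ₂ : σ₂ ∈ Set.Ioo (1 / 2 : ℝ) 1)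
    (hfin : lam (min σ₁ σ₂) < ⊤) :
    lam σ₁ < ⊤ ∧ lam σ₂ < ⊤ ∧
      |(lam σ₁).toReal - (lam σ₂).toReal|
        ≤ ((lam (min σ₁ σ₂)).toReal / (1 - min σ₁ σ₂)) * |σ₁ - σ₂| := by
  have hA : ∀ u, 0 ≤ A u := fun u =>
    nonneg_of_mul_nonneg_right ((hB u).trans (hBA u)) (by exact_mod_cast hN)
  simp only [hlam] at hfin ⊢
  rcases le_total σ₁ σ₂ with h | h
  · rw [min_eq_left h] at hfin ⊢
    rw [abs_sub_comm σ₁ σ₂, abs_of_nonneg (sub_nonneg.2 h)]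
    exact ⟨hfin, minmaxVal_convexComb_sub_le j hA hB hσ₁.1 h hσ₂.2 hfin⟩
  · rw [min_eq_right h] at hfin ⊢
    rw [abs_of_nonneg (sub_nonneg.2 h), abs_sub_comm]
    obtain ⟨h₁, h₂⟩ := minmaxVal_convexComb_sub_le j hA hB hσ₂.1 h hσ₁.2 hfin
    exact ⟨h₁, hfin, h₂⟩
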